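/- For every integer k ≥ 1 there exists a finite family F of 3-graphs whose Turán density equals μ_k, where μ_1 = 1/√3 and μ_{k+1} = 1/√(3 − 2μ_k); that is, every term of the continued-radical sequence 1/√3, 1/√(3 − 2/√3), 1/√(3 − 2/√(3 − 2/√3)), … is the Turán density of a finite family of 3-graphs. -/

import Mathlib

/-- `H` is an `r`-graph on vertex set `Fin n`: every edge is an `r`-element subset. -/
def IsRGraph (r n : ℕ) (H : Finset (Finset (Fin n))) : Prop :=
  ∀ e ∈ H, e.card = r

/-- `G` (on `Fin a`) appears as a subgraph of `H` (on `Fin n`): there is an injection of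
vertices mapping every edge of `G` to an edge of `H`. -/
def ContainsCopy {a n : ℕ} (G : Finset (Finset (Fin a))) (H : Finset (Finset (Fin n))) : Prop :=
  ∃ f : Fin a → Fin n, Function.Injective f ∧ ∀ e ∈ G, e.image f ∈ H

/-- `H` is `F`-free: no member of the family `F` appears as a subgraph of `H`. -/
def IsFree {n : ℕ} (F : Finset ((a : ℕ) × Finset (Finset (Fin a))))
    (H : Finset (Finset (Fin n))) : Prop :=
  ∀ G ∈ F, ¬ ContainsCopy G.2 H

/-- The Turán number `ex(n, F)`: the maximum number of edges of an `F`-free `r`-graph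
on `n` vertices. -/
noncomputable def exTuran (r : ℕ) (F : Finset ((a : ℕ) × Finset (Finset (Fin a))))
    (n : ℕ) : ℕ :=
  sSup {k | ∃ H : Finset (Finset (Fin n)), IsRGraph r n H ∧ IsFree F H ∧ H.card = k}

/-- The sequence `μ_k`: `μ_1 = 1/√3` and `μ_{k+1} = 1/√(3 - 2 μ_k)`
(the value `μ_0 = 0` is a junk value making the recursion total). -/
noncomputable def mu : ℕ → ℝ
  | 0 => 0
  | k + 1 => 1 / Real.sqrt (3 - 2 * mu k)

open Finset

/-- The Lagrange polynomial of `H` evaluated at the weights `x`. -/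
def lagrangePoly {n : ℕ} (H : Finset (Finset (Fin n))) (x : Fin n → ℝ) : ℝ :=
  ∑ e ∈ H, ∏ i ∈ e, x i

/-- Every `F`-free 3-graph has Lagrangian at most `d / 6`. -/
def HasLagrangianBound (F : Finset ((a : ℕ) × Finset (Finset (Fin a)))) (d : ℝ) : Prop :=
  ∀ (n : ℕ) (H : Finset (Finset (Fin n))), IsRGraph 3 n H → IsFree F H →
    ∀ x : Fin n → ℝ, (∀ i, 0 ≤ x i) → lagrangePoly H x ≤ d / 6 * (∑ i, x i) ^ 3

/-- There are `F`-free 3-graphs of asymptotic density `d`, and they can be placed on any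
subset of any vertex set. -/
def HasDenseConstruction (F : Finset ((a : ℕ) × Finset (Finset (Fin a)))) (d : ℝ) : Prop :=
  ∃ h : ℕ → ℕ, Filter.Tendsto (fun n : ℕ => (h n : ℝ) / (n : ℝ) ^ 3) Filter.atTop (nhds (d / 6)) ∧
    ∀ (n : ℕ) (C : Finset (Fin n)), ∃ H ⊆ powersetCard 3 C, IsFree F H ∧ h #C ≤ #H

/-- Every two vertices of `P` lie in a common edge of `H`. -/
def CoversPairs {n : ℕ} (H : Finset (Finset (Fin n))) (P : Finset (Fin n)) : Prop :=
  ∀ u ∈ P, ∀ v ∈ P, u ≠ v → ∃ e ∈ H, u ∈ e ∧ v ∈ e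

/-- No two vertices of `P` can be deleted so as to make `H[P]` an `F`-free graph. -/
def IsRobust (F : Finset ((a : ℕ) × Finset (Finset (Fin a)))) {n : ℕ}
    (H : Finset (Finset (Fin n))) (P : Finset (Fin n)) : Prop :=
  ∀ T : Finset (Fin n), #T ≤ 2 → ¬ IsFree F {e ∈ H | e ⊆ P \ T}

open Classical in
/-- The 3-graphs on at most `M` vertices that have a pair-covering robust core. -/
noncomputable def robustFamily (F : Finset ((a : ℕ) × Finset (Finset (Fin a)))) (M : ℕ) :
    Finset ((a : ℕ) × Finset (Finset (Fin a))) :=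
  (range (M + 1)).sigma fun m => {G | IsRGraph 3 m G ∧ ∃ P, CoversPairs G P ∧ IsRobust F G P}

theorem mem_robustFamily {F : Finset ((a : ℕ) × Finset (Finset (Fin a)))} {M m : ℕ}
    {G : Finset (Finset (Fin m))} :
    (⟨m, G⟩ : (a : ℕ) × Finset (Finset (Fin a))) ∈ robustFamily F M ↔
      m ≤ M ∧ IsRGraph 3 m G ∧ ∃ P, CoversPairs G P ∧ IsRobust F G P := by
  simp [robustFamily]

theorem IsFree.mono {F : Finset ((a : ℕ) × Finset (Finset (Fin a)))} {n : ℕ}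
    {H H' : Finset (Finset (Fin n))} (hH : IsFree F H) (h : H' ⊆ H) : IsFree F H' := by
  rintro G hG ⟨f, hf, hfe⟩
  exact hH G hG ⟨f, hf, fun e he => h (hfe e he)⟩

/-! ### Robust cores of bounded size -/

/-- A robust set contains a robust subset lying in a vertex set of bounded size that also
contains the relevant copies of members of `F`. -/
theorem IsRobust.exists_small {F : Finset ((a : ℕ) × Finset (Finset (Fin a)))} {s : ℕ}
    (hs : ∀ G ∈ F, G.1 ≤ s) {n : ℕ} {H : Finset (Finset (Fin n))} {S : Finset (Fin n)}
    (hS : IsRobust F H S) :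
    ∃ Q : Finset (Fin n), #Q ≤ (fun q => q + 2 ^ q * s)^[3] 0 ∧
      ∀ T : Finset (Fin n), #T ≤ 2 → ∃ G ∈ F, ∃ f : Fin G.1 → Fin n, Function.Injective f ∧
        (∀ i, f i ∈ Q) ∧ ∀ e ∈ G.2, e.image f ∈ H ∧ e.image f ⊆ (S ∩ Q) \ T := by
  have key : ∀ T : Finset (Fin n), ∃ R : Finset (Fin n), #R ≤ s ∧ (#T ≤ 2 →
      ∃ G ∈ F, ∃ f : Fin G.1 → Fin n, Function.Injective f ∧
        (∀ i, f i ∈ R) ∧ ∀ e ∈ G.2, e.image f ∈ H ∧ e.image f ⊆ S \ T) := by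
    intro T
    by_cases hT : #T ≤ 2
    · have h := hS T hT
      simp only [IsFree, ContainsCopy, not_forall, not_not] at h
      obtain ⟨G, hG, f, hf, hfe⟩ := h
      refine ⟨univ.image f, ?_, fun _ => ⟨G, hG, f, hf, fun i => mem_image_of_mem _ (mem_univ i),
        fun e he => ?_⟩⟩
      · rw [card_image_of_injective _ hf, card_univ, Fintype.card_fin]
        exact hs G hG
      · simpa using hfe e he
    · exact ⟨∅, by simp, fun h => absurd h hT⟩
  choose R hRs hR using key
  let g : Finset (Fin n) → Finset (Fin n) := fun Q => Q ∪ Q.powerset.biUnion R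
  have hg : ∀ Q, Q ⊆ g Q := fun Q => subset_union_left
  have hRg : ∀ Q T, T ⊆ Q → R T ⊆ g Q := fun Q T hT =>
    (subset_biUnion_of_mem R (mem_powerset.2 hT)).trans subset_union_right
  have hgc : ∀ Q q, #Q ≤ q → #(g Q) ≤ q + 2 ^ q * s := by
    intro Q q hq
    calc #(g Q) ≤ #Q + #(Q.powerset.biUnion R) := card_union_le _ _
      _ ≤ #Q + #Q.powerset * s := by
          gcongr
          exact card_biUnion_le_card_mul _ _ _ fun T _ => hRs T
      _ ≤ q + 2 ^ q * s := by
          rw [card_powerset]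
          gcongr
          norm_num
  have hstable : ∀ T : Finset (Fin n), #T ≤ 2 →
      ∃ Q, g Q ⊆ g (g (g ∅)) ∧ T ∩ g Q = T ∩ Q := by
    intro T hT
    by_contra! hcon
    have hstep : ∀ Q, g Q ⊆ g (g (g ∅)) → #(T ∩ Q) < #(T ∩ g Q) := fun Q hQ =>
      card_lt_card ((inter_subset_inter_left (hg Q)).ssubset_of_ne (hcon Q hQ).symm)
    have h1 := hstep ∅ ((hg _).trans (hg _))
    have h2 := hstep (g ∅) (hg _)
    have h3 := hstep (g (g ∅)) subset_rfl
    have h4 : #(T ∩ g (g (g ∅))) ≤ #T := card_le_card inter_subset_left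
    omega
  refine ⟨g (g (g ∅)), hgc _ _ (hgc _ _ (hgc _ _ (by simp))), fun T hT => ?_⟩
  obtain ⟨Q, hQ, hTQ⟩ := hstable T hT
  obtain ⟨G, hG, f, hf, hfR, hfe⟩ := hR (T ∩ Q) ((card_le_card inter_subset_left).trans hT)
  have hfQ : ∀ i, f i ∈ g Q := fun i => hRg Q _ inter_subset_right (hfR i)
  refine ⟨G, hG, f, hf, fun i => hQ (hfQ i), fun e he => ⟨(hfe e he).1, fun v hv => ?_⟩⟩
  have hvS := mem_sdiff.1 ((hfe e he).2 hv)
  have hvQ : v ∈ g Q := by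
    obtain ⟨i, -, rfl⟩ := mem_image.1 hv
    exact hfQ i
  refine mem_sdiff.2 ⟨mem_inter.2 ⟨hvS.1, hQ hvQ⟩, fun hvT => hvS.2 ?_⟩
  rw [← hTQ]
  exact mem_inter.2 ⟨hvT, hvQ⟩

theorem exists_robustFamily_bound (F : Finset ((a : ℕ) × Finset (Finset (Fin a)))) :
    ∃ M : ℕ, ∀ (n : ℕ) (H : Finset (Finset (Fin n))) (S : Finset (Fin n)), IsRGraph 3 n H →
      IsFree (robustFamily F M) H → CoversPairs H S → ¬ IsRobust F H S := by
  set K := (fun q => q + 2 ^ q * F.sup Sigma.fst)^[3] 0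
  refine ⟨K + K * K * 3, fun n H S hH hfree hcov hrob => ?_⟩
  obtain ⟨Q, hQ, hcopy⟩ := hrob.exists_small (fun G hG => le_sup (f := Sigma.fst) hG)
  have hE : ∀ p : Fin n × Fin n, ∃ E : Finset (Fin n), #E ≤ 3 ∧
      (p.1 ∈ S → p.2 ∈ S → p.1 ≠ p.2 → E ∈ H ∧ p.1 ∈ E ∧ p.2 ∈ E) := by
    intro p
    by_cases hp : p.1 ∈ S ∧ p.2 ∈ S ∧ p.1 ≠ p.2
    · obtain ⟨e, he, h⟩ := hcov _ hp.1 _ hp.2.1 hp.2.2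
      exact ⟨e, (hH e he).le, fun _ _ _ => ⟨he, h⟩⟩
    · exact ⟨∅, by simp, fun h1 h2 h3 => absurd ⟨h1, h2, h3⟩ hp⟩
  choose E hE3 hE using hE
  set W := Q ∪ (Q ×ˢ Q).biUnion E with hW
  have hQW : Q ⊆ W := subset_union_left
  have hWc : #W ≤ K + K * K * 3 := by
    calc #W ≤ #Q + #((Q ×ˢ Q).biUnion E) := card_union_le _ _
      _ ≤ #Q + #(Q ×ˢ Q) * 3 := by
          gcongr
          exact card_biUnion_le_card_mul _ _ _ fun p _ => hE3 p
      _ ≤ K + K * K * 3 := by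
          rw [card_product]
          gcongr
  let ι : Fin #W → Fin n := fun i => W.orderEmbOfFin rfl i
  have hι : Function.Injective ι := (W.orderEmbOfFin rfl).injective
  have hιW : ∀ v ∈ W, ∃ i, ι i = v := fun v hv => by
    have : v ∈ Set.range (W.orderEmbOfFin rfl) := by
      rw [range_orderEmbOfFin]; exact hv
    exact this
  have hpre : ∀ e ⊆ W, ({i | ι i ∈ e} : Finset (Fin #W)).image ι = e := by
    intro e he
    ext v
    simp only [mem_image, mem_filter, mem_univ, true_and]
    constructor
    · rintro ⟨i, hi, rfl⟩; exact hi
    · intro hv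
      obtain ⟨i, rfl⟩ := hιW v (he hv)
      exact ⟨i, hv, rfl⟩
  let G : Finset (Finset (Fin #W)) := {e | e.image ι ∈ H}
  have hGmem : ∀ e, e ∈ G ↔ e.image ι ∈ H := fun e => by simp [G]
  refine hfree ⟨#W, G⟩ (mem_robustFamily.2 ⟨hWc, fun e he => ?_,
    ({i | ι i ∈ S ∩ Q} : Finset (Fin #W)), ?_, ?_⟩) ⟨ι, hι, fun e he => (hGmem e).1 he⟩
  · rw [← card_image_of_injective e hι]
    exact hH _ ((hGmem e).1 he)
  · intro u hu v hv huv
    simp only [mem_filter, mem_univ, true_and, mem_inter] at hu hv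
    obtain ⟨h1, h2, h3⟩ := hE (ι u, ι v) hu.1 hv.1 (hι.ne huv)
    have hsub : E (ι u, ι v) ⊆ W :=
      (subset_biUnion_of_mem E (mem_product.2 ⟨hu.2, hv.2⟩)).trans subset_union_right
    refine ⟨({i | ι i ∈ E (ι u, ι v)} : Finset (Fin #W)), ?_, by simpa using h2, by simpa using h3⟩
    rw [hGmem, hpre _ hsub]
    exact h1
  · intro T hT hTfree
    obtain ⟨G₀, hG₀, f, hf, hfQ, hfe⟩ := hcopy (T.image ι) (card_image_le.trans hT)
    choose f' hf' using fun i => hιW (f i) (hQW (hfQ i))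
    have himg : ∀ e : Finset (Fin G₀.1), (e.image f').image ι = e.image f := by
      intro e
      rw [image_image]
      exact image_congr fun i _ => hf' i
    refine hTfree G₀ hG₀ ⟨f', fun i j hij => hf (by rw [← hf' i, ← hf' j, hij]), fun e he => ?_⟩
    rw [mem_filter, hGmem, himg]
    refine ⟨(hfe e he).1, fun i hi => ?_⟩
    have h := (hfe e he).2 (himg e ▸ mem_image_of_mem ι hi)
    simp only [mem_sdiff, mem_filter, mem_univ, true_and] at h ⊢
    exact ⟨h.1, fun hiT => h.2 (mem_image_of_mem ι hiT)⟩

/-! ### The Lagrangian bound -/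

/-- Weight can be moved between two vertices not lying in a common edge without decreasing the
Lagrange polynomial, so its values are controlled by weights with pair-covered support. -/
theorem lagrangePoly_le_of_coversPairs_support {n : ℕ} (H : Finset (Finset (Fin n))) {c : ℝ}
    (hc : ∀ x : Fin n → ℝ, (∀ i, 0 ≤ x i) → CoversPairs H {i | x i ≠ 0} →
      lagrangePoly H x ≤ c * (∑ i, x i) ^ 3)
    (x : Fin n → ℝ) (hx : ∀ i, 0 ≤ x i) : lagrangePoly H x ≤ c * (∑ i, x i) ^ 3 := by
  induction hN : #{i | x i ≠ 0} using Nat.strong_induction_on generalizing x with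
  | _ N ih =>
  subst hN
  by_cases hcov : CoversPairs H {i | x i ≠ 0}
  · exact hc x hx hcov
  simp only [CoversPairs, mem_filter, mem_univ, true_and, not_forall, not_exists, not_and] at hcov
  obtain ⟨u, hu, v, hv, huv, hH⟩ := hcov
  have hu0 : 0 < x u := (hx u).lt_of_ne' hu
  have hv0 : 0 < x v := (hx v).lt_of_ne' hv
  let shift : Fin n → Fin n → Fin n → ℝ := fun a b =>
    Function.update (Function.update x a (x u + x v)) b 0
  have hshift0 : ∀ a b i, 0 ≤ shift a b i := by
    intro a b i
    simp only [shift, Function.update_apply]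
    split_ifs
    · exact le_rfl
    · positivity
    · exact hx i
  have hsum : ∀ a b, a ≠ b → x a + x b = x u + x v → ∑ i, shift a b i = ∑ i, x i := by
    intro a b hab habs
    simp only [shift]
    rw [sum_update_of_mem (mem_univ b), ← erase_eq, sum_update_of_mem (by simp [hab]),
      ← add_sum_erase univ x (mem_univ b),
      ← add_sum_erase (univ.erase b) x (mem_erase.2 ⟨hab, mem_univ a⟩), erase_eq (univ.erase b)]
    linarith
  have hlt : ∀ a b, a ≠ b → x a ≠ 0 → x b ≠ 0 → #{i | shift a b i ≠ 0} < #{i | x i ≠ 0} := by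
    intro a b hab ha hb
    refine card_lt_card ⟨fun i hi => ?_, fun h => ?_⟩
    · simp only [mem_filter, mem_univ, true_and, shift, Function.update_apply] at hi ⊢
      split_ifs at hi with h1 h2
      · exact absurd rfl hi
      · exact h2 ▸ ha
      · exact hi
    · have : b ∈ ({i | shift a b i ≠ 0} : Finset (Fin n)) := h (by simpa using hb)
      simp [shift] at this
  have hconv : (x u + x v) * lagrangePoly H x =
      x u * lagrangePoly H (shift u v) + x v * lagrangePoly H (shift v u) := by
    simp only [lagrangePoly, mul_sum, ← sum_add_distrib]
    refine sum_congr rfl fun e he => ?_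
    have hrest : ∀ a b, a ∉ e → b ∉ e → ∏ i ∈ e, shift a b i = ∏ i ∈ e, x i := by
      intro a b ha hb
      refine prod_congr rfl fun i hi => ?_
      simp [shift, Function.update_of_ne (ne_of_mem_of_not_mem hi ha),
        Function.update_of_ne (ne_of_mem_of_not_mem hi hb)]
    have hone : ∀ a b, a ∈ e → b ∉ e →
        x a * ∏ i ∈ e, shift a b i = (x u + x v) * ∏ i ∈ e, x i := by
      intro a b ha hb
      have hab : a ≠ b := ne_of_mem_of_not_mem ha hb
      rw [← mul_prod_erase e x ha, ← mul_prod_erase e _ ha,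
        prod_congr rfl (g := x) fun i hi => ?_]
      · simp only [shift, Function.update_of_ne hab, Function.update_self]
        ring
      · simp [shift, Function.update_of_ne (mem_erase.1 hi).1,
          Function.update_of_ne (ne_of_mem_of_not_mem (mem_erase.1 hi).2 hb)]
    have hzero : ∀ a b, b ∈ e → ∏ i ∈ e, shift a b i = 0 := fun a b hb =>
      prod_eq_zero hb (by simp [shift])
    by_cases hue : u ∈ e
    · have hve : v ∉ e := hH e he hue
      rw [hone u v hue hve, hzero v u hue]
      ring
    · by_cases hve : v ∈ e
      · rw [hone v u hve hue, hzero u v hve]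
        ring
      · rw [hrest u v hue hve, hrest v u hve hue]
        ring
  have h1 := ih _ (hlt u v huv hu hv) _ (hshift0 u v) rfl
  have h2 := ih _ (hlt v u huv.symm hv hu) _ (hshift0 v u) rfl
  rw [hsum u v huv rfl] at h1
  rw [hsum v u huv.symm (add_comm _ _)] at h2
  nlinarith [mul_le_mul_of_nonneg_left h1 hu0.le, mul_le_mul_of_nonneg_left h2 hv0.le]

theorem lagrangePoly_mono {n : ℕ} {H H' : Finset (Finset (Fin n))} (h : H ⊆ H') {x : Fin n → ℝ}
    (hx : ∀ i, 0 ≤ x i) : lagrangePoly H x ≤ lagrangePoly H' x :=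
  sum_le_sum_of_subset_of_nonneg h fun _ _ _ => prod_nonneg fun i _ => hx i

theorem lagrangePoly_union_le {n : ℕ} (H H' : Finset (Finset (Fin n))) {x : Fin n → ℝ}
    (hx : ∀ i, 0 ≤ x i) : lagrangePoly (H ∪ H') x ≤ lagrangePoly H x + lagrangePoly H' x := by
  have h := sum_union_inter (s₁ := H) (s₂ := H') (f := fun e => ∏ i ∈ e, x i)
  have h' : 0 ≤ ∑ e ∈ H ∩ H', ∏ i ∈ e, x i := sum_nonneg fun _ _ => prod_nonneg fun i _ => hx i
  simp only [lagrangePoly]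
  linarith

theorem lagrangePoly_image_insert {n : ℕ} {a : Fin n} {Z : Finset (Fin n)} (ha : a ∉ Z) (k : ℕ)
    (x : Fin n → ℝ) :
    lagrangePoly ((powersetCard k Z).image (insert a)) x =
      x a * lagrangePoly (powersetCard k Z) x := by
  have hmem : ∀ e ∈ powersetCard k Z, a ∉ e := fun e he h => ha ((mem_powersetCard.1 he).1 h)
  rw [lagrangePoly, lagrangePoly, sum_image, mul_sum]
  · exact sum_congr rfl fun e he => prod_insert (hmem e he)
  · intro e he e' he' hee'
    rw [← erase_insert (hmem e he), ← erase_insert (hmem e' he')]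
    exact congrArg (fun s => erase s a) hee'

theorem lagrangePoly_powersetCard_one {n : ℕ} (Z : Finset (Fin n)) (x : Fin n → ℝ) :
    lagrangePoly (powersetCard 1 Z) x = ∑ i ∈ Z, x i := by
  simp [lagrangePoly, powersetCard_one]

theorem lagrangePoly_powersetCard_two_insert_le {n : ℕ} {a : Fin n} {Z : Finset (Fin n)}
    (ha : a ∉ Z) {x : Fin n → ℝ} (hx : ∀ i, 0 ≤ x i) :
    lagrangePoly (powersetCard 2 (insert a Z)) x ≤
      lagrangePoly (powersetCard 2 Z) x + x a * ∑ i ∈ Z, x i := by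
  rw [powersetCard_succ_insert ha, ← lagrangePoly_powersetCard_one,
    ← lagrangePoly_image_insert ha]
  exact lagrangePoly_union_le _ _ hx

theorem lagrangePoly_powersetCard_two_le {n : ℕ} (Z : Finset (Fin n)) {x : Fin n → ℝ}
    (hx : ∀ i, 0 ≤ x i) :
    lagrangePoly (powersetCard 2 Z) x ≤ (∑ i ∈ Z, x i) ^ 2 / 2 := by
  induction Z using Finset.induction_on with
  | empty =>
    rw [powersetCard_eq_empty.2 (by simp)]
    simp [lagrangePoly]
  | insert a Z ha ih =>
    have h := lagrangePoly_powersetCard_two_insert_le ha hx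
    rw [sum_insert ha]
    nlinarith [sq_nonneg (x a)]

theorem lagrangePoly_filter_subset_support {n : ℕ} (H : Finset (Finset (Fin n))) (x : Fin n → ℝ)
    (Z : Finset (Fin n)) :
    lagrangePoly {e ∈ H | e ⊆ ({i | x i ≠ 0} : Finset (Fin n)) \ Z} x =
      lagrangePoly {e ∈ H | e ⊆ Zᶜ} x := by
  refine sum_subset (fun e he => ?_) fun e he he' => ?_
  · rw [mem_filter] at he ⊢
    exact ⟨he.1, he.2.trans fun i hi => mem_compl.2 (mem_sdiff.1 hi).2⟩
  · rw [mem_filter] at he he'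
    have : ¬ e ⊆ ({i | x i ≠ 0} : Finset (Fin n)) := fun h =>
      he' ⟨he.1, fun i hi => mem_sdiff.2 ⟨h hi, mem_compl.1 (he.2 hi)⟩⟩
    obtain ⟨i, hi, hi'⟩ := not_subset.1 this
    exact prod_eq_zero hi (by simpa using hi')

theorem HasLagrangianBound.le_sum_of_subset {F : Finset ((a : ℕ) × Finset (Finset (Fin a)))}
    {d : ℝ} (hF : HasLagrangianBound F d) {n : ℕ} {H : Finset (Finset (Fin n))}
    (hH : IsRGraph 3 n H) (hfree : IsFree F H) {Z : Finset (Fin n)} (hZ : ∀ e ∈ H, e ⊆ Z)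
    {x : Fin n → ℝ} (hx : ∀ i, 0 ≤ x i) :
    lagrangePoly H x ≤ d / 6 * (∑ i ∈ Z, x i) ^ 3 := by
  have h := hF n H hH hfree (fun i => if i ∈ Z then x i else 0) fun i => by
    split_ifs
    exacts [hx i, le_rfl]
  rw [sum_ite_mem, univ_inter] at h
  refine le_of_eq_of_le (sum_congr rfl fun e he => prod_congr rfl fun i hi => ?_) h
  exact (if_pos (hZ e he hi)).symm

/-- The optimization over the total weight of the two deleted vertices. -/
theorem cubic_le_of_sq_mul_eq_one {d m p q y : ℝ} (hm : 0 < m) (hmd : m ^ 2 * (3 - 2 * d) = 1)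
    (hp : 0 ≤ p) (hq : 0 ≤ q) (hy : 0 ≤ y) :
    d / 6 * y ^ 3 + p * (y ^ 2 / 2 + q * y) + q * (y ^ 2 / 2) ≤ m / 6 * (p + q + y) ^ 3 := by
  have hmy : 0 ≤ (y - m * (p + q + y)) ^ 2 * (y + 2 * m * (p + q + y)) := by positivity
  have hpq : 0 ≤ m ^ 2 * (y * (p - q) ^ 2) := by positivity
  have : 0 ≤ m ^ 2 * (m / 6 * (p + q + y) ^ 3 -
      (d / 6 * y ^ 3 + p * (y ^ 2 / 2 + q * y) + q * (y ^ 2 / 2))) := by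
    have hd : m ^ 2 * d = (3 * m ^ 2 - 1) / 2 := by linarith
    have : m ^ 2 * (m / 6 * (p + q + y) ^ 3 -
        (d / 6 * y ^ 3 + p * (y ^ 2 / 2 + q * y) + q * (y ^ 2 / 2))) =
        (y - m * (p + q + y)) ^ 2 * (y + 2 * m * (p + q + y)) / 12 +
        m ^ 2 * (y * (p - q) ^ 2) / 4 - (m ^ 2 * d - (3 * m ^ 2 - 1) / 2) * y ^ 3 / 6 := by
      ring
    rw [this, hd]
    linarith
  have := nonneg_of_mul_nonneg_right this (by positivity)
  linarith

theorem HasLagrangianBound.robustFamily {F : Finset ((a : ℕ) × Finset (Finset (Fin a)))} {d m : ℝ}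
    (hF : HasLagrangianBound F d) (hm : 0 < m) (hmd : m ^ 2 * (3 - 2 * d) = 1) {M : ℕ}
    (hM : ∀ (n : ℕ) (H : Finset (Finset (Fin n))) (S : Finset (Fin n)), IsRGraph 3 n H →
      IsFree (robustFamily F M) H → CoversPairs H S → ¬ IsRobust F H S) :
    HasLagrangianBound (robustFamily F M) m := by
  intro n H hH hfree
  refine lagrangePoly_le_of_coversPairs_support H fun x hx hcov => ?_
  have h := hM n H _ hH hfree hcov
  simp only [IsRobust, not_forall, not_not] at h
  obtain ⟨T, hT, hTfree⟩ := h
  rcases lt_or_ge n 2 with hn | hn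
  · have hempty : H = ∅ := eq_empty_of_forall_notMem fun e he => by
      have h1 := hH e he
      have h2 := card_le_univ e
      rw [Fintype.card_fin] at h2
      omega
    have := sum_nonneg fun i (_ : i ∈ univ) => hx i
    rw [hempty, lagrangePoly, sum_empty]
    positivity
  obtain ⟨T', hTT', hT'⟩ := exists_superset_card_eq hT (by simpa using hn)
  obtain ⟨a, b, hab, rfl⟩ := card_eq_two.1 hT'
  set Z : Finset (Fin n) := {a, b}ᶜ with hZ
  have hbZ : b ∉ Z := by simp [hZ]
  have haZ : a ∉ insert b Z := by simp [hZ, hab]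
  have hins : insert a (insert b Z) = univ := by
    ext i
    simp only [hZ, mem_insert, mem_compl, mem_singleton, mem_univ, iff_true]
    tauto
  have hsum : ∑ i, x i = x a + x b + ∑ i ∈ Z, x i := by
    rw [← hins, sum_insert haZ, sum_insert hbZ, add_assoc]
  have hinner : lagrangePoly {e ∈ H | e ⊆ Z} x ≤ d / 6 * (∑ i ∈ Z, x i) ^ 3 := by
    rw [hZ, ← lagrangePoly_filter_subset_support]
    refine hF.le_sum_of_subset (fun e he => hH e (mem_filter.1 he).1)
      (hTfree.mono fun e he => ?_) (fun e he => (mem_filter.1 he).2.trans fun i hi => ?_) hx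
    · rw [mem_filter] at he ⊢
      exact ⟨he.1, he.2.trans (sdiff_subset_sdiff subset_rfl hTT')⟩
    · exact mem_compl.2 (mem_sdiff.1 hi).2
  have hsub : H ⊆ {e ∈ H | e ⊆ Z} ∪ ((powersetCard 2 (insert b Z)).image (insert a) ∪
      (powersetCard 2 Z).image (insert b)) := by
    intro e he
    have h3 : e ∈ powersetCard 3 (insert a (insert b Z)) := by
      rw [hins]
      exact mem_powersetCard.2 ⟨subset_univ e, hH e he⟩
    rw [powersetCard_succ_insert haZ, powersetCard_succ_insert hbZ] at h3
    simp only [mem_union] at h3 ⊢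
    rcases h3 with (h3 | h3) | h3
    · exact Or.inl (mem_filter.2 ⟨he, (mem_powersetCard.1 h3).1⟩)
    · exact Or.inr (Or.inr h3)
    · exact Or.inr (Or.inl h3)
  have hy : 0 ≤ ∑ i ∈ Z, x i := sum_nonneg fun i _ => hx i
  have hpair := lagrangePoly_powersetCard_two_le Z hx
  calc lagrangePoly H x
      ≤ lagrangePoly {e ∈ H | e ⊆ Z} x + (x a * lagrangePoly (powersetCard 2 (insert b Z)) x +
          x b * lagrangePoly (powersetCard 2 Z) x) := by
        rw [← lagrangePoly_image_insert haZ, ← lagrangePoly_image_insert hbZ]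
        refine (lagrangePoly_mono hsub hx).trans ((lagrangePoly_union_le _ _ hx).trans ?_)
        gcongr
        exact lagrangePoly_union_le _ _ hx
    _ ≤ d / 6 * (∑ i ∈ Z, x i) ^ 3 + (x a * ((∑ i ∈ Z, x i) ^ 2 / 2 + x b * ∑ i ∈ Z, x i) +
          x b * ((∑ i ∈ Z, x i) ^ 2 / 2)) := by
        have ha0 := hx a
        have hb0 := hx b
        gcongr
        exact (lagrangePoly_powersetCard_two_insert_le hbZ hx).trans (by gcongr)
    _ ≤ m / 6 * (∑ i, x i) ^ 3 := by
        rw [hsum, ← add_assoc]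
        exact cubic_le_of_sq_mul_eq_one hm hmd (hx a) (hx b) hy

/-! ### The construction -/

/-- The sets obtained by adding a vertex of `A` to a member of `Q`. -/
def joinFamily {n : ℕ} (A : Finset (Fin n)) (Q : Finset (Finset (Fin n))) :
    Finset (Finset (Fin n)) :=
  (A ×ˢ Q).image fun p => insert p.1 p.2

theorem mem_joinFamily {n : ℕ} {A : Finset (Fin n)} {Q : Finset (Finset (Fin n))}
    {e : Finset (Fin n)} : e ∈ joinFamily A Q ↔ ∃ a ∈ A, ∃ q ∈ Q, insert a q = e := by
  simp [joinFamily, and_assoc]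

theorem card_joinFamily {n : ℕ} {A : Finset (Fin n)} {Q : Finset (Finset (Fin n))}
    (hQ : ∀ q ∈ Q, Disjoint A q) : #(joinFamily A Q) = #A * #Q := by
  rw [joinFamily, card_image_of_injOn, card_product]
  rintro ⟨a, q⟩ hp ⟨a', q'⟩ hp' h
  simp only [coe_product, Set.mem_prod, mem_coe] at hp hp'
  have hA : ∀ b ∈ A, ∀ r ∈ Q, insert b r ∩ A = {b} ∧ insert b r \ A = r := by
    intro b hb r hr
    rw [insert_inter_of_mem hb, insert_sdiff_of_mem _ hb,
      disjoint_iff_inter_eq_empty.1 (hQ r hr).symm, sdiff_eq_self_of_disjoint (hQ r hr).symm]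
    exact ⟨rfl, rfl⟩
  have h1 := hA a hp.1 q hp.2
  have h2 := hA a' hp'.1 q' hp'.2
  simp only at h
  rw [h] at h1
  ext1
  · exact singleton_injective (h1.1.symm.trans h2.1)
  · exact h1.2.symm.trans h2.2

/-- The triples meeting `C` that have at most one vertex in each of `A` and `B` and at least
one vertex in `A ∪ B`. -/
def crossTriples {n : ℕ} (A B C : Finset (Fin n)) : Finset (Finset (Fin n)) :=
  joinFamily A (joinFamily B (powersetCard 1 C)) ∪ joinFamily (A ∪ B) (powersetCard 2 C)

theorem mem_crossTriples {n : ℕ} {A B C e : Finset (Fin n)} :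
    e ∈ crossTriples A B C ↔ (∃ a ∈ A, ∃ b ∈ B, ∃ c ∈ C, {a, b, c} = e) ∨
      ∃ a ∈ A ∪ B, ∃ q ∈ powersetCard 2 C, insert a q = e := by
  simp only [crossTriples, mem_union (s := joinFamily _ _), mem_joinFamily, powersetCard_one,
    mem_map, Function.Embedding.coeFn_mk]
  refine or_congr_left ⟨?_, ?_⟩
  · rintro ⟨a, ha, q, ⟨b, hb, r, ⟨c, hc, rfl⟩, rfl⟩, rfl⟩
    exact ⟨a, ha, b, hb, c, hc, rfl⟩
  · rintro ⟨a, ha, b, hb, c, hc, rfl⟩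
    exact ⟨a, ha, _, ⟨b, hb, _, ⟨c, hc, rfl⟩, rfl⟩, rfl⟩

section

variable {n : ℕ} {A B C : Finset (Fin n)}

theorem card_of_mem_crossTriples (hAB : Disjoint A B) (hAC : Disjoint A C) (hBC : Disjoint B C)
    {e : Finset (Fin n)} (he : e ∈ crossTriples A B C) : #e = 3 := by
  rcases mem_crossTriples.1 he with ⟨a, ha, b, hb, c, hc, rfl⟩ | ⟨a, ha, q, hq, rfl⟩
  · exact card_eq_three.2 ⟨a, b, c, disjoint_left.1 hAB ha |> ne_of_mem_of_not_mem hb |>.symm,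
      disjoint_left.1 hAC ha |> ne_of_mem_of_not_mem hc |>.symm,
      disjoint_left.1 hBC hb |> ne_of_mem_of_not_mem hc |>.symm, rfl⟩
  · rw [mem_powersetCard] at hq
    rw [card_insert_of_notMem, hq.2]
    exact fun haq => disjoint_left.1 (disjoint_union_left.2 ⟨hAC, hBC⟩) ha (hq.1 haq)

theorem subset_of_mem_crossTriples {e : Finset (Fin n)} (he : e ∈ crossTriples A B C) :
    e ⊆ A ∪ B ∪ C := by
  rcases mem_crossTriples.1 he with ⟨a, ha, b, hb, c, hc, rfl⟩ | ⟨a, ha, q, hq, rfl⟩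
  · intro i
    simp only [mem_insert, mem_singleton, mem_union]
    rintro (rfl | rfl | rfl) <;> tauto
  · exact insert_subset (mem_union_left _ ha) ((mem_powersetCard.1 hq).1.trans subset_union_right)

theorem exists_mem_union_of_mem_crossTriples {e : Finset (Fin n)} (he : e ∈ crossTriples A B C) :
    ∃ i ∈ e, i ∈ A ∪ B := by
  rcases mem_crossTriples.1 he with ⟨a, ha, b, hb, c, hc, rfl⟩ | ⟨a, ha, q, hq, rfl⟩
  · exact ⟨a, by simp, mem_union_left _ ha⟩
  · exact ⟨a, by simp, ha⟩

theorem eq_of_mem_crossTriples (hAB : Disjoint A B) (hAC : Disjoint A C) (hBC : Disjoint B C)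
    {e : Finset (Fin n)} (he : e ∈ crossTriples A B C) {i j : Fin n} (hi : i ∈ e) (hj : j ∈ e)
    (hij : i ∈ A ∧ j ∈ A ∨ i ∈ B ∧ j ∈ B) : i = j := by
  have hAB' := disjoint_left.1 hAB
  have hAC' := disjoint_left.1 hAC
  have hBC' := disjoint_left.1 hBC
  rcases mem_crossTriples.1 he with ⟨a, ha, b, hb, c, hc, rfl⟩ | ⟨a, ha, q, hq, rfl⟩
  · simp only [mem_insert, mem_singleton] at hi hj
    grind
  · have hqC := (mem_powersetCard.1 hq).1
    simp only [mem_insert] at hi hj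
    grind

theorem card_crossTriples (hAB : Disjoint A B) (hAC : Disjoint A C) (hBC : Disjoint B C) :
    #(crossTriples A B C) = #A * (#B * #C) + (#A + #B) * (#C).choose 2 := by
  rw [crossTriples, card_union_of_disjoint, card_joinFamily, card_joinFamily, card_joinFamily,
    card_powersetCard, card_powersetCard, Nat.choose_one_right, card_union_of_disjoint hAB]
  · exact fun q hq => (disjoint_union_left.2 ⟨hAC, hBC⟩).mono_right (mem_powersetCard.1 hq).1
  · exact fun q hq => hBC.mono_right (mem_powersetCard.1 hq).1
  · intro q hq
    obtain ⟨b, hb, r, hr, rfl⟩ := mem_joinFamily.1 hq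
    exact disjoint_insert_right.2
      ⟨fun h => disjoint_left.1 hAB h hb, hAC.mono_right (mem_powersetCard.1 hr).1⟩
  · rw [disjoint_left]
    intro e he he'
    obtain ⟨a, ha, q, hq, rfl⟩ := mem_joinFamily.1 he
    obtain ⟨b, hb, r, hr, rfl⟩ := mem_joinFamily.1 hq
    obtain ⟨d, hd, s, hs, hds⟩ := mem_joinFamily.1 he'
    have hsC := (mem_powersetCard.1 hs).1
    have ha' : a ∈ insert d s := hds ▸ mem_insert_self _ _
    have hb' : b ∈ insert d s := hds ▸ mem_insert_of_mem (mem_insert_self _ _)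
    have h1 : a = d := (mem_insert.1 ha').resolve_right fun h => disjoint_left.1 hAC ha (hsC h)
    have h2 : b = d := (mem_insert.1 hb').resolve_right fun h => disjoint_left.1 hBC hb (hsC h)
    exact disjoint_left.1 hAB ha (h1.trans h2.symm ▸ hb)

theorem isFree_robustFamily_crossTriples_union {F : Finset ((a : ℕ) × Finset (Finset (Fin a)))}
    (hAB : Disjoint A B) (hAC : Disjoint A C) (hBC : Disjoint B C) {H : Finset (Finset (Fin n))}
    (hH : H ⊆ powersetCard 3 C) (hfree : IsFree F H) (M : ℕ) :
    IsFree (robustFamily F M) (crossTriples A B C ∪ H) := by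
  rintro ⟨m, G⟩ hG ⟨g, hg, hge⟩
  obtain ⟨-, -, P, hcov, hrob⟩ := mem_robustFamily.1 hG
  have huniq : ∀ D, D = A ∨ D = B → #{v ∈ P | g v ∈ D} ≤ 1 := by
    intro D hD
    refine card_le_one.2 fun u hu v hv => by_contra fun huv => ?_
    rw [mem_filter] at hu hv
    obtain ⟨e, he, hue, hve⟩ := hcov u hu.1 v hv.1 huv
    have hgu := mem_image_of_mem g hue
    have hgv := mem_image_of_mem g hve
    rcases mem_union.1 (hge e he) with h | h
    · refine huv (hg (eq_of_mem_crossTriples hAB hAC hBC h hgu hgv ?_))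
      rcases hD with rfl | rfl
      exacts [Or.inl ⟨hu.2, hv.2⟩, Or.inr ⟨hu.2, hv.2⟩]
    · have hC : g u ∈ C := (mem_powersetCard.1 (hH h)).1 hgu
      rcases hD with rfl | rfl
      exacts [disjoint_left.1 hAC hu.2 hC, disjoint_left.1 hBC hu.2 hC]
  refine hrob ({v ∈ P | g v ∈ A} ∪ {v ∈ P | g v ∈ B}) ((card_union_le _ _).trans
    (add_le_add (huniq A (Or.inl rfl)) (huniq B (Or.inr rfl)))) ?_
  rintro G₀ hG₀ ⟨f, hf, hfe⟩
  refine hfree G₀ hG₀ ⟨g ∘ f, hg.comp hf, fun e he => ?_⟩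
  have h := mem_filter.1 (hfe e he)
  rw [← image_image]
  refine (mem_union.1 (hge _ h.1)).resolve_left fun hcross => ?_
  obtain ⟨i, hi, hiAB⟩ := exists_mem_union_of_mem_crossTriples hcross
  obtain ⟨v, hv, rfl⟩ := mem_image.1 hi
  have hvP := mem_sdiff.1 (h.2 hv)
  refine hvP.2 ?_
  simpa [hvP.1] using hiAB

end

theorem HasDenseConstruction.robustFamily {F : Finset ((a : ℕ) × Finset (Finset (Fin a)))}
    {d m : ℝ} (hF : HasDenseConstruction F d) (hm : 0 < m) (hm1 : m < 1)
    (hmd : m ^ 2 * (3 - 2 * d) = 1) (M : ℕ) : HasDenseConstruction (robustFamily F M) m := by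
  obtain ⟨h, hlim, hcon⟩ := hF
  let c : ℕ → ℕ := fun n => ⌊m * n⌋₊
  let a : ℕ → ℕ := fun n => ⌊(1 - m) / 2 * n⌋₊
  have hac : ∀ n, a n + a n + c n ≤ n := by
    intro n
    have h1 : (c n : ℝ) ≤ m * n := Nat.floor_le (by positivity)
    have h2 : (a n : ℝ) ≤ (1 - m) / 2 * n := Nat.floor_le
      (mul_nonneg (by linarith) (Nat.cast_nonneg n))
    have : ((a n + a n + c n : ℕ) : ℝ) ≤ n := by
      push_cast
      linarith
    exact_mod_cast this
  refine ⟨fun n => a n * (a n * c n) + (a n + a n) * (c n).choose 2 + h (c n), ?_, ?_⟩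
  · have hc : Filter.Tendsto (fun n : ℕ => (c n : ℝ) / n) Filter.atTop (nhds m) :=
      (tendsto_nat_floor_mul_div_atTop hm.le).comp tendsto_natCast_atTop_atTop
    have ha : Filter.Tendsto (fun n : ℕ => (a n : ℝ) / n) Filter.atTop (nhds ((1 - m) / 2)) :=
      (tendsto_nat_floor_mul_div_atTop (by linarith)).comp tendsto_natCast_atTop_atTop
    have hinv : Filter.Tendsto (fun n : ℕ => 1 / (n : ℝ)) Filter.atTop (nhds 0) :=
      tendsto_one_div_atTop_nhds_zero_nat
    have hctop : Filter.Tendsto c Filter.atTop Filter.atTop :=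
      tendsto_nat_floor_atTop.comp (tendsto_natCast_atTop_atTop.const_mul_atTop hm)
    have hh := hlim.comp hctop
    have hall := ((ha.mul (ha.mul hc)).add ((ha.add ha).mul
      ((hc.mul (hc.sub hinv)).div_const 2))).add (hh.mul (hc.pow 3))
    have hval : (1 - m) / 2 * ((1 - m) / 2 * m) + ((1 - m) / 2 + (1 - m) / 2) *
        (m * (m - 0) / 2) + d / 6 * m ^ 3 = m / 6 := by
      linear_combination (-m / 12) * hmd
    rw [hval] at hall
    refine hall.congr' ?_
    filter_upwards [Filter.eventually_gt_atTop 0, hctop.eventually_gt_atTop 0] with n hn hcn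
    have hn' : (n : ℝ) ≠ 0 := by positivity
    have hcn' : (c n : ℝ) ≠ 0 := by positivity
    simp only [Function.comp_apply]
    push_cast [Nat.cast_choose_two]
    field_simp
  · intro n C
    have hC := hac #C
    obtain ⟨A, hAC, hA⟩ := exists_subset_card_eq (show a #C ≤ #C by omega)
    obtain ⟨B, hBC, hB⟩ := exists_subset_card_eq (s := C \ A) (n := a #C)
      (by rw [card_sdiff_of_subset hAC]; omega)
    have hBC' : B ⊆ C := hBC.trans sdiff_subset
    have hABd : Disjoint A B := disjoint_sdiff.mono_right hBC
    obtain ⟨D, hDC, hD⟩ := exists_subset_card_eq (s := C \ (A ∪ B)) (n := c #C)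
      (by rw [card_sdiff_of_subset (union_subset hAC hBC'), card_union_of_disjoint hABd]; omega)
    have hDC' : D ⊆ C := hDC.trans sdiff_subset
    have hABD : Disjoint (A ∪ B) D := disjoint_sdiff.mono_right hDC
    obtain ⟨hAD, hBD⟩ := disjoint_union_left.1 hABD
    obtain ⟨H, hH, hfree, hcard⟩ := hcon n D
    refine ⟨crossTriples A B D ∪ H, fun e he => ?_,
      isFree_robustFamily_crossTriples_union hABd hAD hBD hH hfree M, ?_⟩
    · rcases mem_union.1 he with he | he
      · exact mem_powersetCard.2 ⟨(subset_of_mem_crossTriples he).trans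
          (union_subset (union_subset hAC hBC') hDC'), card_of_mem_crossTriples hABd hAD hBD he⟩
      · exact powersetCard_mono hDC' (hH he)
    · rw [card_union_of_disjoint, card_crossTriples hABd hAD hBD, hA, hB, hD]
      · rw [hD] at hcard
        exact Nat.add_le_add_left hcard _
      · rw [disjoint_left]
        intro e he heH
        obtain ⟨i, hi, hiAB⟩ := exists_mem_union_of_mem_crossTriples he
        exact disjoint_left.1 hABD hiAB ((mem_powersetCard.1 (hH heH)).1 hi)

/-! ### Turán densities -/

theorem hasLagrangianBound_singleEdge :
    HasLagrangianBound {⟨3, {univ}⟩} 0 := by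
  intro n H hH hfree x hx
  have hempty : H = ∅ := eq_empty_of_forall_notMem fun e he => by
    refine hfree ⟨3, {univ}⟩ (mem_singleton_self _)
      ⟨e.orderEmbOfFin (hH e he), (e.orderEmbOfFin (hH e he)).injective, fun e' he' => ?_⟩
    rw [mem_singleton.1 he', image_orderEmbOfFin_univ]
    exact he
  simp [hempty, lagrangePoly]

theorem hasDenseConstruction_singleEdge :
    HasDenseConstruction {⟨3, {univ}⟩} 0 := by
  refine ⟨fun _ => 0, by simp, fun n C => ⟨∅, by simp, ?_, by simp⟩⟩
  intro G hG
  rw [mem_singleton] at hG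
  subst hG
  rintro ⟨f, -, hf⟩
  simpa using hf univ (mem_singleton_self _)

theorem mu_nonneg_and_lt_one (k : ℕ) : 0 ≤ mu k ∧ mu k < 1 := by
  induction k with
  | zero => simp [mu]
  | succ k ih =>
    have h : 1 < Real.sqrt (3 - 2 * mu k) := Real.lt_sqrt_of_sq_lt (by linarith [ih.2])
    rw [mu]
    exact ⟨by positivity, (div_lt_one (by linarith)).2 h⟩

theorem mu_succ_pos (k : ℕ) : 0 < mu (k + 1) := by
  have := (mu_nonneg_and_lt_one k).2
  rw [mu]
  exact one_div_pos.2 (Real.sqrt_pos.2 (by linarith))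

theorem mu_succ_sq_mul (k : ℕ) : mu (k + 1) ^ 2 * (3 - 2 * mu k) = 1 := by
  have h : 0 < 3 - 2 * mu k := by linarith [(mu_nonneg_and_lt_one k).2]
  rw [mu, div_pow, Real.sq_sqrt h.le]
  field_simp

theorem exists_family_mu (k : ℕ) : ∃ F : Finset ((a : ℕ) × Finset (Finset (Fin a))),
    (∀ G ∈ F, IsRGraph 3 G.1 G.2) ∧ HasLagrangianBound F (mu k) ∧
      HasDenseConstruction F (mu k) := by
  induction k with
  | zero =>
    refine ⟨{⟨3, {univ}⟩}, ?_, hasLagrangianBound_singleEdge, hasDenseConstruction_singleEdge⟩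
    simp [IsRGraph]
  | succ k ih =>
    obtain ⟨F, -, hbound, hdense⟩ := ih
    obtain ⟨M, hM⟩ := exists_robustFamily_bound F
    exact ⟨robustFamily F M, fun G hG => (mem_robustFamily.1 hG).2.1,
      hbound.robustFamily (mu_succ_pos k) (mu_succ_sq_mul k) hM,
      hdense.robustFamily (mu_succ_pos k) (mu_nonneg_and_lt_one _).2 (mu_succ_sq_mul k) M⟩

theorem tendsto_exTuran_div_choose {F : Finset ((a : ℕ) × Finset (Finset (Fin a)))} {d : ℝ}
    (hbound : HasLagrangianBound F d) (hdense : HasDenseConstruction F d) :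
    Filter.Tendsto (fun n : ℕ => (exTuran 3 F n : ℝ) / (n.choose 3 : ℝ))
      Filter.atTop (nhds d) := by
  obtain ⟨h, hlim, hcon⟩ := hdense
  have hbdd : ∀ n, BddAbove {k | ∃ H : Finset (Finset (Fin n)),
      IsRGraph 3 n H ∧ IsFree F H ∧ #H = k} := fun n =>
    ⟨_, by rintro k ⟨H, -, -, rfl⟩; exact card_le_univ H⟩
  have hlow : ∀ n, ∃ H : Finset (Finset (Fin n)), IsRGraph 3 n H ∧ IsFree F H ∧ h n ≤ #H := by
    intro n
    obtain ⟨H, hH, hfree, hcard⟩ := hcon n univ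
    exact ⟨H, fun e he => (mem_powersetCard.1 (hH he)).2, hfree, by simpa using hcard⟩
  have hle : ∀ n, h n ≤ exTuran 3 F n := by
    intro n
    obtain ⟨H, hH, hfree, hcard⟩ := hlow n
    exact hcard.trans (le_csSup (hbdd n) ⟨H, hH, hfree, rfl⟩)
  have hge : ∀ n, (exTuran 3 F n : ℝ) ≤ d / 6 * (n : ℝ) ^ 3 := by
    intro n
    obtain ⟨H₀, hH₀, hfree₀, -⟩ := hlow n
    obtain ⟨H, hH, hfree, hcard⟩ : ∃ H : Finset (Finset (Fin n)),
        IsRGraph 3 n H ∧ IsFree F H ∧ #H = exTuran 3 F n :=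
      Nat.sSup_mem (s := {k | ∃ H : Finset (Finset (Fin n)),
        IsRGraph 3 n H ∧ IsFree F H ∧ #H = k}) ⟨_, H₀, hH₀, hfree₀, rfl⟩ (hbdd n)
    rw [← hcard]
    simpa [lagrangePoly] using hbound n H hH hfree (fun _ => 1) fun _ => zero_le_one
  have hex : Filter.Tendsto (fun n : ℕ => (exTuran 3 F n : ℝ) / (n : ℝ) ^ 3)
      Filter.atTop (nhds (d / 6)) := by
    refine tendsto_of_tendsto_of_tendsto_of_le_of_le' hlim tendsto_const_nhds
      (Filter.Eventually.of_forall fun n => ?_) ?_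
    · have := hle n
      gcongr
    · filter_upwards [Filter.eventually_gt_atTop 0] with n hn
      rw [div_le_iff₀ (by positivity)]
      exact hge n
  have hequiv := (Asymptotics.IsEquivalent.refl (u := fun n : ℕ => (exTuran 3 F n : ℝ))).div
    (isEquivalent_choose 3)
  refine hequiv.symm.tendsto_nhds ?_
  have h6 := hex.const_mul 6
  rw [mul_div_cancel₀ d (by norm_num : (6 : ℝ) ≠ 0)] at h6
  refine h6.congr fun n => ?_
  simp only [Pi.div_apply, Nat.factorial]
  push_cast
  rw [div_div_eq_mul_div]
  ring

/-- For every integer `k ≥ 1` there is a finite family `F` of 3-graphs whose Turán density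
`π(F) = lim_{n → ∞} ex(n, F) / C(n, 3)` equals `μ_k`, where `μ_1 = 1/√3` and
`μ_{k+1} = 1/√(3 - 2 μ_k)`. -/
theorem continued_radical_is_turan_density (k : ℕ) (hk : 1 ≤ k) :
    ∃ F : Finset ((a : ℕ) × Finset (Finset (Fin a))),
      (∀ G ∈ F, IsRGraph 3 G.1 G.2) ∧
      Filter.Tendsto (fun n : ℕ => (exTuran 3 F n : ℝ) / (n.choose 3 : ℝ))
        Filter.atTop (nhds (mu k)) := by
  obtain ⟨F, hF, hbound, hdense⟩ := exists_family_mu k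
  exact ⟨F, hF, tendsto_exTuran_div_choose hbound hdense⟩
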